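/- For a nonempty finite weighted hypergraph G, exactly one of the following holds: (1) the energy function f attains a minimum on U; (2) G is disconnected. -/

import Mathlib

open Finset in
/-- The energy function of a weighted hypergraph. -/
noncomputable def hyperEnergy {k l d : ℕ} (e : Fin l → Finset (Fin k))
    (c : Fin l → ℝ) (w : Fin k → ℝ) (α β γ δ : ℝ)
    (x : Fin k → EuclideanSpace ℝ (Fin d)) : ℝ :=
  α / 2 * ∑ j, c j * ∑ i ∈ e j,
      ‖x i - ((e j).card : ℝ)⁻¹ • ∑ i' ∈ e j, x i'‖ ^ γ
  + β / 2 * ∑ j : Fin k, ∑ i ∈ univ.erase j, w i * w j / ‖x i - x j‖ ^ δ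

/-- A hypergraph on `Fin k` is disconnected if the vertex set splits into two disjoint
nonempty parts with every hyperedge contained in one of the parts. -/
def FinHyperDisconnected {k l : ℕ} (e : Fin l → Finset (Fin k)) : Prop :=
  ∃ V₁ V₂ : Finset (Fin k), V₁ ∪ V₂ = Finset.univ ∧ Disjoint V₁ V₂ ∧
    V₁.Nonempty ∧ V₂.Nonempty ∧ ∀ j, e j ⊆ V₁ ∨ e j ⊆ V₂

section HyperEnergy

open Finset

variable {k l d : ℕ} {e : Fin l → Finset (Fin k)} {c : Fin l → ℝ} {w : Fin k → ℝ}
  {α β γ δ : ℝ}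

/-- Deviations from the barycenter are unchanged by a translation. -/
lemma sub_barycenter_translate {ι E : Type*} [AddCommGroup E] [Module ℝ E]
    {s : Finset ι} {x y : ι → E} {v : E} (h : ∀ i ∈ s, y i = x i + v) {i : ι} (hi : i ∈ s) :
    y i - (s.card : ℝ)⁻¹ • ∑ a ∈ s, y a = x i - (s.card : ℝ)⁻¹ • ∑ a ∈ s, x a := by
  have hs : (s.card : ℝ) ≠ 0 := by
    exact_mod_cast (card_pos.2 ⟨i, hi⟩).ne'
  rw [sum_congr rfl h, h i hi, sum_add_distrib, sum_const, smul_add,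
    ← Nat.cast_smul_eq_nsmul ℝ, smul_smul, inv_mul_cancel₀ hs, one_smul]
  abel

lemma hyperEnergy_translate (x : Fin k → EuclideanSpace ℝ (Fin d))
    (v : EuclideanSpace ℝ (Fin d)) :
    hyperEnergy e c w α β γ δ (fun i => x i + v) = hyperEnergy e c w α β γ δ x := by
  unfold hyperEnergy
  congr 2
  · refine sum_congr rfl fun j _ => ?_
    congr 1
    refine sum_congr rfl fun i hi => ?_
    rw [sub_barycenter_translate (x := x) (y := fun i => x i + v) (fun _ _ => rfl) hi]
  · simp only [add_sub_add_right_eq_sub]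

lemma attraction_le_hyperEnergy (hc : ∀ j, 0 < c j) (hw : ∀ i, 0 < w i) (hα : 0 < α)
    (hβ : 0 < β) (x : Fin k → EuclideanSpace ℝ (Fin d)) {j : Fin l} {i : Fin k}
    (hi : i ∈ e j) :
    α / 2 * (c j * ‖x i - ((e j).card : ℝ)⁻¹ • ∑ i' ∈ e j, x i'‖ ^ γ)
      ≤ hyperEnergy e c w α β γ δ x := by
  have hrep : 0 ≤ β / 2 * ∑ j : Fin k, ∑ i ∈ univ.erase j, w i * w j / ‖x i - x j‖ ^ δ :=
    mul_nonneg (by positivity) <| sum_nonneg fun j _ => sum_nonneg fun i _ =>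
      div_nonneg (mul_pos (hw i) (hw j)).le (by positivity)
  refine le_trans ?_ (le_add_of_nonneg_right hrep)
  refine mul_le_mul_of_nonneg_left ?_ (by positivity)
  refine le_trans ?_ (single_le_sum (f := fun j => c j * ∑ i ∈ e j,
    ‖x i - ((e j).card : ℝ)⁻¹ • ∑ i' ∈ e j, x i'‖ ^ γ)
    (fun j _ => mul_nonneg (hc j).le (sum_nonneg fun i _ => by positivity)) (mem_univ j))
  exact mul_le_mul_of_nonneg_left (single_le_sum
    (f := fun i => ‖x i - ((e j).card : ℝ)⁻¹ • ∑ i' ∈ e j, x i'‖ ^ γ)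
    (fun i _ => by positivity) hi) (hc j).le

lemma repulsion_le_hyperEnergy (hc : ∀ j, 0 < c j) (hw : ∀ i, 0 < w i) (hα : 0 < α)
    (hβ : 0 < β) (x : Fin k → EuclideanSpace ℝ (Fin d)) {i j : Fin k} (hij : i ≠ j) :
    β / 2 * (w i * w j / ‖x i - x j‖ ^ δ) ≤ hyperEnergy e c w α β γ δ x := by
  have hnn : ∀ i j, 0 ≤ w i * w j / ‖x i - x j‖ ^ δ := fun i j =>
    div_nonneg (mul_pos (hw i) (hw j)).le (by positivity)
  have hatt : 0 ≤ α / 2 * ∑ j, c j * ∑ i ∈ e j,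
      ‖x i - ((e j).card : ℝ)⁻¹ • ∑ i' ∈ e j, x i'‖ ^ γ :=
    mul_nonneg (by positivity) <| sum_nonneg fun j _ => mul_nonneg (hc j).le <|
      sum_nonneg fun i _ => by positivity
  refine le_trans ?_ (le_add_of_nonneg_left hatt)
  refine mul_le_mul_of_nonneg_left ?_ (by positivity)
  refine le_trans ?_ (single_le_sum
    (f := fun j => ∑ i ∈ univ.erase j, w i * w j / ‖x i - x j‖ ^ δ)
    (fun j _ => sum_nonneg fun i _ => hnn i j) (mem_univ j))
  exact single_le_sum (f := fun i => w i * w j / ‖x i - x j‖ ^ δ) (fun i _ => hnn i j)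
    (mem_erase.2 ⟨hij, mem_univ i⟩)

/-- Vertices on a common hyperedge stay within bounded distance on sublevel sets. -/
lemma exists_dist_le_of_mem_edge (hc : ∀ j, 0 < c j) (hw : ∀ i, 0 < w i) (hα : 0 < α)
    (hβ : 0 < β) (hγ : 0 < γ) {M : ℝ} (hM : 0 < M) (j : Fin l) :
    ∃ R : ℝ, ∀ x : Fin k → EuclideanSpace ℝ (Fin d), hyperEnergy e c w α β γ δ x ≤ M →
      ∀ a ∈ e j, ∀ b ∈ e j, ‖x a - x b‖ ≤ R := by
  have hcj := hc j
  set R : ℝ := (M / (α / 2 * c j)) ^ γ⁻¹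
  refine ⟨R + R, fun x hx a ha b hb => ?_⟩
  have key : ∀ i ∈ e j, ‖x i - ((e j).card : ℝ)⁻¹ • ∑ i' ∈ e j, x i'‖ ≤ R := fun i hi => by
    rw [Real.le_rpow_inv_iff_of_pos (norm_nonneg _) (by positivity) hγ,
      le_div_iff₀ (by positivity)]
    have := (attraction_le_hyperEnergy (δ := δ) (γ := γ) hc hw hα hβ x hi).trans hx
    linarith
  rw [← sub_sub_sub_cancel_right (x a) (x b) (((e j).card : ℝ)⁻¹ • ∑ i' ∈ e j, x i')]
  exact (norm_sub_le _ _).trans (add_le_add (key a ha) (key b hb))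

/-- Distinct vertices stay uniformly separated on sublevel sets. -/
lemma exists_pos_le_dist (hc : ∀ j, 0 < c j) (hw : ∀ i, 0 < w i) (hα : 0 < α)
    (hβ : 0 < β) (hδ : 0 < δ) {M : ℝ} (hM : 0 < M) (i j : Fin k) :
    ∃ r : ℝ, 0 < r ∧ ∀ x : Fin k → EuclideanSpace ℝ (Fin d), Function.Injective x →
      hyperEnergy e c w α β γ δ x ≤ M → i ≠ j → r ≤ ‖x i - x j‖ := by
  have hi := hw i
  have hj := hw j
  refine ⟨(β / 2 * (w i * w j) / M) ^ δ⁻¹, by positivity, fun x hx hxM hij => ?_⟩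
  have hpos : 0 < ‖x i - x j‖ := norm_pos_iff.2 (sub_ne_zero.2 (hx.ne hij))
  rw [Real.rpow_inv_le_iff_of_pos (by positivity) hpos.le hδ, div_le_iff₀ hM]
  have := (repulsion_le_hyperEnergy (e := e) (γ := γ) (δ := δ) hc hw hα hβ x hij).trans hxM
  rw [← mul_div_assoc, div_le_iff₀ (by positivity)] at this
  linarith

/-- On a connected hypergraph, sublevel sets are bounded up to translation. -/
lemma exists_dist_le_of_connected (hcon : ¬ FinHyperDisconnected e) (hc : ∀ j, 0 < c j)
    (hw : ∀ i, 0 < w i) (hα : 0 < α) (hβ : 0 < β) (hγ : 0 < γ) {M : ℝ} (hM : 0 < M)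
    (i₀ i : Fin k) :
    ∃ B : ℝ, ∀ x : Fin k → EuclideanSpace ℝ (Fin d), hyperEnergy e c w α β γ δ x ≤ M →
      ‖x i - x i₀‖ ≤ B := by
  classical
  set P : Fin k → Prop := fun i => ∃ B : ℝ, ∀ x : Fin k → EuclideanSpace ℝ (Fin d),
    hyperEnergy e c w α β γ δ x ≤ M → ‖x i - x i₀‖ ≤ B
  by_contra hi
  refine hcon ⟨univ.filter P, univ.filter fun i => ¬ P i, filter_union_filter_not_eq _ _,
    disjoint_filter_filter_not _ _ _, ⟨i₀, mem_filter.2 ⟨mem_univ i₀, 0, by simp⟩⟩,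
    ⟨i, mem_filter.2 ⟨mem_univ i, hi⟩⟩, fun j => ?_⟩
  by_cases h : ∃ a ∈ e j, P a
  · obtain ⟨a, ha, B, hB⟩ := h
    obtain ⟨R, hR⟩ := exists_dist_le_of_mem_edge (d := d) (δ := δ) hc hw hα hβ hγ hM j
    refine Or.inl fun b hb => mem_filter.2 ⟨mem_univ b, R + B, fun x hx => ?_⟩
    rw [← sub_add_sub_cancel (x b) (x a) (x i₀)]
    exact (norm_add_le _ _).trans (add_le_add (hR x hx b hb a ha) (hB x hx))
  · exact Or.inr fun b hb => mem_filter.2 ⟨mem_univ b, fun hPb => h ⟨b, hb, hPb⟩⟩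

lemma continuousOn_hyperEnergy (hγ : 0 < γ) (hδ : 0 < δ) :
    ContinuousOn (hyperEnergy (d := d) e c w α β γ δ) {x | Function.Injective x} := by
  unfold hyperEnergy
  refine ContinuousOn.add (Continuous.continuousOn ?_) (continuousOn_const.mul ?_)
  · refine continuous_const.mul (continuous_finsetSum _ fun j _ => continuous_const.mul
      (continuous_finsetSum _ fun i _ => Continuous.rpow_const ?_ fun _ => Or.inr hγ.le))
    fun_prop
  · refine continuousOn_finsetSum _ fun j _ => continuousOn_finsetSum _ fun i hi =>
      continuousOn_const.div ?_ fun x hx => ?_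
    · refine (Continuous.rpow_const ?_ fun _ => Or.inr hδ.le).continuousOn
      fun_prop
    · exact (Real.rpow_pos_of_pos
        (norm_pos_iff.2 (sub_ne_zero.2 (Function.Injective.ne hx (ne_of_mem_erase hi)))) δ).ne'

theorem exists_min_hyperEnergy_of_connected (hk : 1 ≤ k) (hd : 1 ≤ d)
    (hcon : ¬ FinHyperDisconnected e) (hc : ∀ j, 0 < c j) (hw : ∀ i, 0 < w i) (hα : 0 < α)
    (hβ : 0 < β) (hγ : 0 < γ) (hδ : 0 < δ) :
    ∃ xstar : Fin k → EuclideanSpace ℝ (Fin d), Function.Injective xstar ∧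
      ∀ x : Fin k → EuclideanSpace ℝ (Fin d), Function.Injective x →
        hyperEnergy e c w α β γ δ xstar ≤ hyperEnergy e c w α β γ δ x := by
  have : NeZero d := ⟨by omega⟩
  have : Infinite (EuclideanSpace ℝ (Fin d)) := Module.Free.infinite ℝ _
  obtain ⟨x₀, hx₀⟩ : ∃ x : Fin k → EuclideanSpace ℝ (Fin d), Function.Injective x :=
    ⟨_, ((Fin.valEmbedding).trans (Infinite.natEmbedding _)).injective⟩
  set M : ℝ := max (hyperEnergy e c w α β γ δ x₀) 1
  have hM : 0 < M := lt_max_of_lt_right one_pos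
  let i₀ : Fin k := ⟨0, hk⟩
  choose r hr hrle using fun i j =>
    exists_pos_le_dist (d := d) (e := e) (γ := γ) hc hw hα hβ hδ hM i j
  choose B hB using fun i =>
    exists_dist_le_of_connected (d := d) (δ := δ) hcon hc hw hα hβ hγ hM i₀ i
  let K : Set (Fin k → EuclideanSpace ℝ (Fin d)) :=
    {x | (∀ i, ‖x i‖ ≤ B i) ∧ ∀ i j, i ≠ j → r i j ≤ ‖x i - x j‖}
  have hKinj : K ⊆ {x | Function.Injective x} := by
    intro x hx i j hij
    by_contra hne
    have := hx.2 i j hne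
    rw [hij, sub_self, norm_zero] at this
    exact absurd this (hr i j).not_ge
  have hKclosed : IsClosed K := by
    simp only [K, Set.ofPred_and, Set.ofPred_forall]
    refine IsClosed.inter (isClosed_iInter fun i => isClosed_le (by fun_prop) (by fun_prop)) ?_
    exact isClosed_iInter fun i => isClosed_iInter fun j => isClosed_iInter fun _ =>
      isClosed_le (by fun_prop) (by fun_prop)
  have hK : IsCompact K :=
    (isCompact_univ_pi fun i => isCompact_closedBall 0 (B i)).of_isClosed_subset hKclosed
      fun x hx i _ => by simpa using hx.1 i
  have hmem : ∀ x : Fin k → EuclideanSpace ℝ (Fin d), Function.Injective x →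
      hyperEnergy e c w α β γ δ x ≤ M → (fun i => x i + -x i₀) ∈ K := fun x hx hxM =>
    ⟨fun i => by simpa [← sub_eq_add_neg] using hB i x hxM,
      fun i j hij => by simpa using hrle i j x hx hxM hij⟩
  obtain ⟨y, hyK, hy⟩ := hK.exists_isMinOn ⟨_, hmem x₀ hx₀ (le_max_left _ _)⟩
    ((continuousOn_hyperEnergy (e := e) (c := c) (w := w) (α := α) (β := β) hγ hδ).mono hKinj)
  have hle : ∀ x : Fin k → EuclideanSpace ℝ (Fin d), Function.Injective x →
      hyperEnergy e c w α β γ δ x ≤ M →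
      hyperEnergy e c w α β γ δ y ≤ hyperEnergy e c w α β γ δ x := fun x hx hxM => by
    rw [← hyperEnergy_translate x (-x i₀)]
    exact hy (hmem x hx hxM)
  refine ⟨y, hKinj hyK, fun x hx => ?_⟩
  rcases le_total (hyperEnergy e c w α β γ δ x) M with h | h
  · exact hle x hx h
  · exact (hle x₀ hx₀ (le_max_left _ _)).trans ((le_max_left _ _).trans h)

/-- Moving the two parts of a disconnected hypergraph apart strictly decreases the energy. -/
theorem exists_hyperEnergy_lt_of_disconnected (hd : 1 ≤ d) (hdis : FinHyperDisconnected e)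
    (hw : ∀ i, 0 < w i) (hβ : 0 < β) (hδ : 0 < δ)
    {x : Fin k → EuclideanSpace ℝ (Fin d)} (hx : Function.Injective x) :
    ∃ y : Fin k → EuclideanSpace ℝ (Fin d), Function.Injective y ∧
      hyperEnergy e c w α β γ δ y < hyperEnergy e c w α β γ δ x := by
  obtain ⟨V₁, V₂, hU, hD, ⟨a, ha⟩, ⟨b, hb⟩, hE⟩ := hdis
  have : NeZero d := ⟨by omega⟩
  have : Nontrivial (EuclideanSpace ℝ (Fin d)) := inferInstance
  obtain ⟨v, hv⟩ := NormedSpace.exists_lt_norm ℝ (EuclideanSpace ℝ (Fin d))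
    (∑ i, ∑ j, 2 * ‖x i - x j‖)
  have hv' : ∀ i j, 2 * ‖x i - x j‖ < ‖v‖ := fun i j => by
    refine lt_of_le_of_lt ?_ hv
    refine le_trans ?_ (single_le_sum (f := fun i => ∑ j, 2 * ‖x i - x j‖)
      (fun i _ => sum_nonneg fun j _ => by positivity) (mem_univ i))
    exact single_le_sum (f := fun j => 2 * ‖x i - x j‖) (fun j _ => by positivity) (mem_univ j)
  have hcover : ∀ i, i ∉ V₂ → i ∈ V₁ := fun i hi => by
    have := mem_univ i
    rw [← hU, mem_union] at this
    tauto
  set y : Fin k → EuclideanSpace ℝ (Fin d) := fun i => x i + if i ∈ V₂ then v else 0 with hy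
  have hyoff : ∀ i, i ∈ V₁ → y i = x i + 0 := fun i hi => by
    simp [hy, disjoint_left.1 hD hi]
  have hyon : ∀ i, i ∈ V₂ → y i = x i + v := fun i hi => by simp [hy, hi]
  have hcross : ∀ i ∈ V₁, ∀ j ∈ V₂, ‖x i - x j‖ < ‖y i - y j‖ := fun i hi j hj => by
    rw [hyoff i hi, hyon j hj, add_zero]
    have h1 : v = (x i - x j) - (x i - (x j + v)) := by abel
    have h2 := norm_sub_le (x i - x j) (x i - (x j + v))
    rw [← h1] at h2
    linarith [hv' i j]
  have hdist : ∀ i j, ‖x i - x j‖ ≤ ‖y i - y j‖ := fun i j => by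
    by_cases hi : i ∈ V₂ <;> by_cases hj : j ∈ V₂
    · rw [hyon i hi, hyon j hj, add_sub_add_right_eq_sub]
    · rw [norm_sub_rev, norm_sub_rev (y i)]
      exact (hcross j (hcover j hj) i hi).le
    · exact (hcross i (hcover i hi) j hj).le
    · rw [hyoff i (hcover i hi), hyoff j (hcover j hj), add_sub_add_right_eq_sub]
  have hpos : ∀ i j, i ≠ j → 0 < ‖x i - x j‖ := fun i j hij =>
    norm_pos_iff.2 (sub_ne_zero.2 (hx.ne hij))
  refine ⟨y, fun i j hij => ?_, ?_⟩
  · by_contra hne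
    have h := (hpos i j hne).trans_le (hdist i j)
    rw [hij, sub_self, norm_zero] at h
    exact lt_irrefl _ h
  have hatt : ∀ j, ∑ i ∈ e j, ‖y i - ((e j).card : ℝ)⁻¹ • ∑ i' ∈ e j, y i'‖ ^ γ
      = ∑ i ∈ e j, ‖x i - ((e j).card : ℝ)⁻¹ • ∑ i' ∈ e j, x i'‖ ^ γ := fun j => by
    refine sum_congr rfl fun i hi => ?_
    rcases hE j with h | h
    · rw [sub_barycenter_translate (fun i hi => hyoff i (h hi)) hi]
    · rw [sub_barycenter_translate (fun i hi => hyon i (h hi)) hi]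
  have hterm : ∀ j, ∀ i ∈ univ.erase j,
      w i * w j / ‖y i - y j‖ ^ δ ≤ w i * w j / ‖x i - x j‖ ^ δ := fun j i hi => by
    have hp := hpos i j (ne_of_mem_erase hi)
    exact div_le_div_of_nonneg_left (mul_pos (hw i) (hw j)).le (Real.rpow_pos_of_pos hp δ)
      (Real.rpow_le_rpow hp.le (hdist i j) hδ.le)
  have hab : a ≠ b := fun h => disjoint_left.1 hD ha (h ▸ hb)
  unfold hyperEnergy
  simp only [hatt]
  refine add_lt_add_right (mul_lt_mul_of_pos_left ?_ (by positivity)) _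
  refine sum_lt_sum (fun j _ => sum_le_sum (hterm j)) ⟨b, mem_univ b, ?_⟩
  refine sum_lt_sum (hterm b) ⟨a, mem_erase.2 ⟨hab, mem_univ a⟩, ?_⟩
  exact div_lt_div_of_pos_left (mul_pos (hw a) (hw b)) (Real.rpow_pos_of_pos (hpos a b hab) δ)
    (Real.rpow_lt_rpow (norm_nonneg _) (hcross a ha b hb) hδ)

end HyperEnergy

/-- For a nonempty finite weighted hypergraph, exactly one of the following holds:
(1) the energy function attains a minimum on `U`; (2) the hypergraph is disconnected. -/
theorem hyperEnergy_min_xor_disconnected {k l d : ℕ} (hk : 1 ≤ k) (hd : 3 ≤ d)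
    (e : Fin l → Finset (Fin k)) (he : ∀ j, (e j).Nonempty)
    (c : Fin l → ℝ) (w : Fin k → ℝ) (α β γ δ : ℝ)
    (hc : ∀ j, 0 < c j) (hw : ∀ i, 0 < w i)
    (hα : 0 < α) (hβ : 0 < β) (hγ : 0 < γ) (hδ : 0 < δ) :
    Xor' (∃ xstar : Fin k → EuclideanSpace ℝ (Fin d), Function.Injective xstar ∧
            ∀ x : Fin k → EuclideanSpace ℝ (Fin d), Function.Injective x →
              hyperEnergy e c w α β γ δ xstar ≤ hyperEnergy e c w α β γ δ x)
      (FinHyperDisconnected e) := by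
  by_cases hdis : FinHyperDisconnected e
  · refine Or.inr ⟨hdis, fun ⟨x, hx, hmin⟩ => ?_⟩
    obtain ⟨y, hy, hlt⟩ := exists_hyperEnergy_lt_of_disconnected (c := c) (α := α) (γ := γ)
      (by omega) hdis hw hβ hδ hx
    exact (hmin y hy).not_gt hlt
  · exact Or.inl ⟨exists_min_hyperEnergy_of_connected hk (by omega) hdis hc hw hα hβ hγ hδ, hdis⟩
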